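/- Let P : X ↛ Y and P' : X' ↛ Y' be open Petri nets with legs i : X → S, o : Y → S and i' : X' → S', o' : Y' → S'. Their tensor product P ⊗ P' : X ⊔ X' ↛ Y ⊔ Y' is the open Petri net on the coproduct Petri net P + P' (transitions T ⊔ T', places S ⊔ S', induced sources and targets) with legs i ⊔ i' and o ⊔ o'. Then, under the canonical monoid isomorphisms ℕ[X ⊔ X'] ≅ ℕ[X] × ℕ[X'] and ℕ[Y ⊔ Y'] ≅ ℕ[Y] × ℕ[Y'], the reachability relation ■(P ⊗ P') corresponds exactly to the product relation {((x, x'), (y, y')) : (x, y) ∈ ■P and (x', y') ∈ ■P'}. -/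

import Mathlib

universe u

structure PetriNet : Type (u + 1) where
  T : Type u
  S : Type u
  src : T → Multiset S
  tgt : T → Multiset S

def PetriNet.Fires (P : PetriNet.{u}) (τ : P.T) (m n : Multiset P.S) : Prop :=
  P.src τ ≤ m ∧ n + P.src τ = m + P.tgt τ

inductive PetriNet.Reachable (P : PetriNet.{u}) : Multiset P.S → Multiset P.S → Prop
  | refl (m : Multiset P.S) : PetriNet.Reachable P m m
  | step {m m' n : Multiset P.S} (τ : P.T) :
      P.Fires τ m m' → PetriNet.Reachable P m' n → PetriNet.Reachable P m n

/-- An open Petri net `P : X ↛ Y`: a Petri net together with functions from `X` and `Y`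
into its set of places. -/
structure OpenPetri (X Y : Type u) : Type (u + 1) where
  net : PetriNet.{u}
  i : X → net.S
  o : Y → net.S

/-- The reachability relation `■P ⊆ ℕ[X] × ℕ[Y]` of an open Petri net. -/
def OpenPetri.bsq {X Y : Type u} (P : OpenPetri X Y) : Set (Multiset X × Multiset Y) :=
  {p | P.net.Reachable (p.1.map P.i) (p.2.map P.o)}

/-- The coproduct `P + P'` of two Petri nets. -/
def PetriNet.coprod (P P' : PetriNet.{u}) : PetriNet.{u} where
  T := P.T ⊕ P'.T
  S := P.S ⊕ P'.S
  src := Sum.elim (fun τ => (P.src τ).map Sum.inl) (fun τ => (P'.src τ).map Sum.inr)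
  tgt := Sum.elim (fun τ => (P.tgt τ).map Sum.inl) (fun τ => (P'.tgt τ).map Sum.inr)

/-- The tensor product `P ⊗ P' : X ⊔ X' ↛ Y ⊔ Y'` of open Petri nets: the coproduct of the
underlying Petri nets, with legs `i ⊔ i'` and `o ⊔ o'`. -/
def OpenPetri.tensor {X Y X' Y' : Type u} (P : OpenPetri X Y) (P' : OpenPetri X' Y') :
    OpenPetri (X ⊕ X') (Y ⊕ Y') where
  net := P.net.coprod P'.net
  i := Sum.map P.i P'.i
  o := Sum.map P.o P'.o

namespace PetriNet

variable {P Q : PetriNet.{u}}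

theorem Reachable.trans {m n k : Multiset P.S} (h : P.Reachable m n) (h' : P.Reachable n k) :
    P.Reachable m k := by
  induction h with
  | refl => exact h'
  | step τ hτ _ ih => exact .step τ hτ (ih h')

theorem Reachable.add_right {m n : Multiset P.S} (h : P.Reachable m n) (k : Multiset P.S) :
    P.Reachable (m + k) (n + k) := by
  induction h with
  | refl => exact .refl _
  | step τ hτ _ ih =>
    refine .step τ ⟨hτ.1.trans (Multiset.le_add_right _ _), ?_⟩ ih
    rw [add_right_comm, hτ.2, add_right_comm]

theorem Reachable.add_left {m n : Multiset P.S} (h : P.Reachable m n) (k : Multiset P.S) :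
    P.Reachable (k + m) (k + n) := by
  simpa only [add_comm k] using h.add_right k

/-- Additive maps of markings that send each transition to a transition, or to one with equal
source and target, preserve reachability. -/
theorem Reachable.map (f : Multiset P.S →+ Multiset Q.S)
    (hf : ∀ τ, (∃ τ', f (P.src τ) = Q.src τ' ∧ f (P.tgt τ) = Q.tgt τ') ∨
      f (P.src τ) = f (P.tgt τ))
    {m n : Multiset P.S} (h : P.Reachable m n) : Q.Reachable (f m) (f n) := by
  induction h with
  | refl => exact .refl _
  | @step m m' n τ hτ _ ih =>
    have hadd : f m' + f (P.src τ) = f m + f (P.tgt τ) := by rw [← map_add, hτ.2, map_add]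
    obtain ⟨τ', hs, ht⟩ | heq := hf τ
    · obtain ⟨r, rfl⟩ := Multiset.le_iff_exists_add.1 hτ.1
      refine .step τ' ⟨?_, hs ▸ ht ▸ hadd⟩ ih
      rw [map_add, hs]
      exact Multiset.le_add_right _ _
    · rw [heq] at hadd
      rwa [← add_right_cancel hadd]

end PetriNet

/-- The additive extension of a partial function to multisets. -/
def Multiset.filterMapAddHom {α β : Type*} (f : α → Option β) : Multiset α →+ Multiset β where
  toFun := Multiset.filterMap f
  map_zero' := Multiset.filterMap_zero f
  map_add' := Multiset.filterMap_add f

theorem Multiset.filterMap_getLeft?_map_inl {α β : Type*} (s : Multiset α) :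
    (s.map (Sum.inl : α → α ⊕ β)).filterMap Sum.getLeft? = s := by
  induction s using Multiset.induction <;> simp_all

theorem Multiset.filterMap_getLeft?_map_inr {α β : Type*} (s : Multiset β) :
    (s.map (Sum.inr : β → α ⊕ β)).filterMap Sum.getLeft? = 0 := by
  induction s using Multiset.induction with
  | empty => rfl
  | cons a s ih => rw [map_cons, filterMap_cons_none _ _ rfl, ih]

theorem Multiset.filterMap_getRight?_map_inl {α β : Type*} (s : Multiset α) :
    (s.map (Sum.inl : α → α ⊕ β)).filterMap Sum.getRight? = 0 := by
  induction s using Multiset.induction with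
  | empty => rfl
  | cons a s ih => rw [map_cons, filterMap_cons_none _ _ rfl, ih]

theorem Multiset.filterMap_getRight?_map_inr {α β : Type*} (s : Multiset β) :
    (s.map (Sum.inr : β → α ⊕ β)).filterMap Sum.getRight? = s := by
  induction s using Multiset.induction <;> simp_all

theorem Multiset.map_sumMap_add {α α' β β' : Type*} (f : α → β) (f' : α' → β') (s : Multiset α)
    (s' : Multiset α') :
    (s.map Sum.inl + s'.map Sum.inr).map (Sum.map f f') =
      (s.map f).map Sum.inl + (s'.map f').map Sum.inr := by
  simp [map_map, Function.comp_def]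

open Multiset in
theorem PetriNet.coprod_reachable_iff (P P' : PetriNet.{u}) (m n : Multiset P.S)
    (m' n' : Multiset P'.S) :
    (P.coprod P').Reachable (m.map Sum.inl + m'.map Sum.inr) (n.map Sum.inl + n'.map Sum.inr) ↔
      P.Reachable m n ∧ P'.Reachable m' n' := by
  constructor
  · intro h
    constructor
    · have hproj : P.Reachable
          (filterMap Sum.getLeft? (m.map (Sum.inl : _ → P.S ⊕ P'.S) + m'.map Sum.inr))
          (filterMap Sum.getLeft? (n.map (Sum.inl : _ → P.S ⊕ P'.S) + n'.map Sum.inr)) :=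
        h.map (filterMapAddHom Sum.getLeft?) <| by
          rintro (τ | τ)
          · exact .inl ⟨τ, filterMap_getLeft?_map_inl _, filterMap_getLeft?_map_inl _⟩
          · exact .inr ((filterMap_getLeft?_map_inr _).trans
              (filterMap_getLeft?_map_inr _).symm)
      simpa only [filterMap_add, filterMap_getLeft?_map_inl, filterMap_getLeft?_map_inr, add_zero,
        zero_add] using hproj
    · have hproj : P'.Reachable
          (filterMap Sum.getRight? (m.map (Sum.inl : _ → P.S ⊕ P'.S) + m'.map Sum.inr))
          (filterMap Sum.getRight? (n.map (Sum.inl : _ → P.S ⊕ P'.S) + n'.map Sum.inr)) :=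
        h.map (filterMapAddHom Sum.getRight?) <| by
          rintro (τ | τ)
          · exact .inr ((filterMap_getRight?_map_inl _).trans
              (filterMap_getRight?_map_inl _).symm)
          · exact .inl ⟨τ, filterMap_getRight?_map_inr _, filterMap_getRight?_map_inr _⟩
      simpa only [filterMap_add, filterMap_getRight?_map_inl, filterMap_getRight?_map_inr, add_zero,
        zero_add] using hproj
  · rintro ⟨h, h'⟩
    have hl : (P.coprod P').Reachable (m.map Sum.inl) (n.map Sum.inl) :=
      h.map (Q := P.coprod P') (mapAddMonoidHom Sum.inl) fun τ => .inl ⟨Sum.inl τ, rfl, rfl⟩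
    have hr : (P.coprod P').Reachable (m'.map Sum.inr) (n'.map Sum.inr) :=
      h'.map (Q := P.coprod P') (mapAddMonoidHom Sum.inr) fun τ => .inl ⟨Sum.inr τ, rfl, rfl⟩
    exact (hl.add_right _).trans (hr.add_left _)

/-- Under the canonical isomorphisms `ℕ[X ⊔ X'] ≅ ℕ[X] × ℕ[X']` and
`ℕ[Y ⊔ Y'] ≅ ℕ[Y] × ℕ[Y']` (whose inverses send `(x, x')` to `ℕ[inl](x) + ℕ[inr](x')`),
the reachability relation `■(P ⊗ P')` corresponds exactly to the product relation
`{((x, x'), (y, y')) : (x, y) ∈ ■P and (x', y') ∈ ■P'}`. -/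
theorem bsq_tensor {X Y X' Y' : Type u} (P : OpenPetri X Y) (P' : OpenPetri X' Y')
    (x : Multiset X) (x' : Multiset X') (y : Multiset Y) (y' : Multiset Y') :
    (x.map Sum.inl + x'.map Sum.inr, y.map Sum.inl + y'.map Sum.inr) ∈ (P.tensor P').bsq
      ↔ ((x, y) ∈ P.bsq ∧ (x', y') ∈ P'.bsq) :=
  (iff_of_eq <| congrArg₂ (P.net.coprod P'.net).Reachable
    (Multiset.map_sumMap_add P.i P'.i x x') (Multiset.map_sumMap_add P.o P'.o y y')).trans
    (P.net.coprod_reachable_iff P'.net _ _ _ _)
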